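/- Let d be an integer with 2 ≤ d ≤ 25 and let Z = ℤ[Θ_{ijk} : i,j,k ≥ 0, i+j+k = d] be the polynomial ring over ℤ in independent variables Θ_{ijk} indexed by monomials of degree d in three variables. Then there exist 2d×2d skew-symmetric matrices A₀, A₁, A₂ with entries in Z such that, in the polynomial ring Z[X₀,X₁,X₂], Pf(X₀·A₀ + X₁·A₁ + X₂·A₂) = Σ_{i+j+k=d} Θ_{ijk}·X₀^i X₁^j X₂^k, i.e. the generic homogeneous form of degree d in three variables admits a linear Pfaffian representation over Z. -/

import Mathlib

/-- The Pfaffian of a `2n × 2n` skew-symmetric matrix over a commutative ring,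
defined recursively by a Laplace-type expansion along the last row:
`Pf(M) = m₁₂` for `n = 1`, and
`Pf(M) = ∑_{j=1}^{2n-1} (-1)ʲ · m_{2n,j} · Pf(M^{2n,j})` for `n ≥ 2`, where
`M^{2n,j}` is obtained from `M` by deleting the `2n`-th and `j`-th rows and columns. -/
def matrixPfaffian {R : Type*} [CommRing R] :
    (n : ℕ) → Matrix (Fin (2 * n)) (Fin (2 * n)) R → R
  | 0, _ => 1
  | n + 1, M =>
      ∑ j : Fin (2 * n + 1),
        (-1 : R) ^ ((j : ℕ) + 1) * M (Fin.last (2 * n + 1)) j.castSucc *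
          matrixPfaffian n (fun a b => M ((j.succAbove a).castSucc) ((j.succAbove b).castSucc))

open MvPolynomial Matrix

/-- The polynomial ring `ℤ[Θ_{ijk} : i,j,k ≥ 0, i+j+k = d]` in independent variables
indexed by the monomials of degree `d` in three variables. -/
abbrev GenericCoeffRing (d : ℕ) : Type :=
  MvPolynomial {p : ℕ × ℕ × ℕ // p.1 + p.2.1 + p.2.2 = d} ℤ

namespace PfRep

section general
variable {A : Type*} [CommRing A]

/-- Block matrix `[[N, -Bᵀ], [B, 0]]`, with `m + 2` columns and `m` rows in `B`. -/
def G (m : ℕ) (N : Fin (m + 2) → Fin (m + 2) → A) (b : ℕ → Fin (m + 2) → A) :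
    Matrix (Fin (2 * (m + 1))) (Fin (2 * (m + 1))) A := fun p q =>
  if hp : p.1 < m + 2 then
    if hq : q.1 < m + 2 then N ⟨p, hp⟩ ⟨q, hq⟩ else - b (q.1 - (m + 2)) ⟨p, hp⟩
  else if hq : q.1 < m + 2 then b (p.1 - (m + 2)) ⟨q, hq⟩ else 0

lemma G_minor (m : ℕ) (N : Fin (m + 3) → Fin (m + 3) → A) (b : ℕ → Fin (m + 3) → A)
    (j : Fin (m + 3)) (J : Fin (2 * (m + 1) + 1)) (hJ : J.1 = j.1) :
    (fun a c => G (m + 1) N b ((J.succAbove a).castSucc) ((J.succAbove c).castSucc)) =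
      G m (fun a c => N (j.succAbove a) (j.succAbove c)) (fun r c => b r (j.succAbove c)) := by
  have h1 : ∀ (a : Fin (2 * (m + 1))) (ha : a.1 < m + 2),
      ((J.succAbove a).castSucc).1 = (j.succAbove ⟨a.1, ha⟩).1 := by
    intro a ha
    simp only [Fin.val_castSucc, Fin.succAbove, Fin.lt_def, hJ]
    split_ifs <;> simp
  have h2 : ∀ (a : Fin (2 * (m + 1))) (ha : ¬ a.1 < m + 2),
      ((J.succAbove a).castSucc).1 = a.1 + 1 := by
    intro a ha
    have := j.2
    simp only [Fin.val_castSucc, Fin.succAbove, Fin.lt_def, hJ]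
    split_ifs <;> simp <;> omega
  have h3 : ∀ (a : Fin (2 * (m + 1))) (ha : a.1 < m + 2),
      ((J.succAbove a).castSucc).1 < m + 1 + 2 := by
    intro a ha; rw [h1 a ha]; exact (j.succAbove ⟨a.1, ha⟩).2
  have h4 : ∀ (a : Fin (2 * (m + 1))) (ha : a.1 < m + 2)
      (h : ((J.succAbove a).castSucc).1 < m + 1 + 2),
      (⟨((J.succAbove a).castSucc).1, h⟩ : Fin (m + 1 + 2)) = j.succAbove ⟨a.1, ha⟩ := by
    intro a ha h; apply Fin.ext; exact h1 a ha
  have h5 : ∀ (a : Fin (2 * (m + 1))) (ha : ¬ a.1 < m + 2),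
      ¬ ((J.succAbove a).castSucc).1 < m + 1 + 2 := by
    intro a ha; rw [h2 a ha]; omega
  have h6 : ∀ (a : Fin (2 * (m + 1))) (ha : ¬ a.1 < m + 2),
      ((J.succAbove a).castSucc).1 - (m + 1 + 2) = a.1 - (m + 2) := by
    intro a ha; rw [h2 a ha]; omega
  funext a c
  unfold G
  by_cases ha : a.1 < m + 2 <;> by_cases hc : c.1 < m + 2
  · rw [dif_pos (h3 a ha), dif_pos (h3 c hc), dif_pos ha, dif_pos hc, h4 a ha, h4 c hc]
  · rw [dif_pos (h3 a ha), dif_neg (h5 c hc), dif_pos ha, dif_neg hc, h4 a ha, h6 c hc]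
  · rw [dif_neg (h5 a ha), dif_pos (h3 c hc), dif_neg ha, dif_pos hc, h6 a ha, h4 c hc]
  · rw [dif_neg (h5 a ha), dif_neg (h5 c hc), dif_neg ha, dif_neg hc]

lemma pf_step (m : ℕ) (N : Fin (m + 3) → Fin (m + 3) → A) (b : ℕ → Fin (m + 3) → A) :
    matrixPfaffian (m + 2) (G (m + 1) N b) =
      ∑ j : Fin (m + 3), (-1 : A) ^ (j.1 + 1) * b m j *
        matrixPfaffian (m + 1) (G m (fun a c => N (j.succAbove a) (j.succAbove c))
          (fun r c => b r (j.succAbove c))) := by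
  rw [matrixPfaffian]
  symm
  have hle : m + 3 ≤ 2 * (m + 1) + 1 := by omega
  refine Finset.sum_of_injOn (fun j : Fin (m + 3) => Fin.castLE hle j)
    ((Fin.castLE_injective hle).injOn) (by intro x _; simp) ?_ ?_
  · intro J _ hJ
    have : ¬ J.1 < m + 1 + 2 := by
      intro h
      exact hJ ⟨⟨J.1, h⟩, by simp, by simp⟩
    have h0 : G (m + 1) N b (Fin.last (2 * (m + 1) + 1)) J.castSucc = 0 := by
      unfold G
      rw [dif_neg, dif_neg]
      · simpa using this
      · simp; omega
    rw [h0]; ring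
  · intro j _
    have h0 : G (m + 1) N b (Fin.last (2 * (m + 1) + 1)) (Fin.castLE hle j).castSucc = b m j := by
      unfold G
      rw [dif_neg, dif_pos]
      · congr 1
        simp; omega
      · simp
      · simp; omega
    rw [h0, G_minor m N b j _ (by simp)]
    simp

lemma pf_add (m : ℕ) (N N' : Fin (m + 2) → Fin (m + 2) → A) (b : ℕ → Fin (m + 2) → A) :
    matrixPfaffian (m + 1) (G m (fun i j => N i j + N' i j) b) =
      matrixPfaffian (m + 1) (G m N b) + matrixPfaffian (m + 1) (G m N' b) := by
  induction m with
  | zero => simp [matrixPfaffian, G]; ring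
  | succ m ih =>
    simp only [pf_step]
    rw [← Finset.sum_add_distrib]
    refine Finset.sum_congr rfl fun j _ => ?_
    rw [ih]; ring

lemma pf_smul (m : ℕ) (t : A) (N : Fin (m + 2) → Fin (m + 2) → A) (b : ℕ → Fin (m + 2) → A) :
    matrixPfaffian (m + 1) (G m (fun i j => t * N i j) b) =
      t * matrixPfaffian (m + 1) (G m N b) := by
  induction m with
  | zero => simp [matrixPfaffian, G]
  | succ m ih =>
    simp only [pf_step]
    rw [Finset.mul_sum]
    refine Finset.sum_congr rfl fun j _ => ?_
    rw [ih]; ring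

/-- The square matrix with rows `u`, `v`, followed by the rows of `b`. -/
def D (m : ℕ) (u v : Fin (m + 2) → A) (b : ℕ → Fin (m + 2) → A) :
    Matrix (Fin (m + 2)) (Fin (m + 2)) A := fun i j =>
  if i.1 = 0 then u j else if i.1 = 1 then v j else b (i.1 - 2) j

lemma pf_wedge (m : ℕ) : ∃ e : ℕ, ∀ (u v : Fin (m + 2) → A) (b : ℕ → Fin (m + 2) → A),
    matrixPfaffian (m + 1) (G m (fun i j => u i * v j - u j * v i) b) =
      (-1) ^ e * (D m u v b).det := by
  induction m with
  | zero =>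
    refine ⟨0, fun u v b => ?_⟩
    simp [matrixPfaffian, G, D, Matrix.det_fin_two]
  | succ m ih =>
    obtain ⟨e, he⟩ := ih
    refine ⟨e + m + 1, fun u v b => ?_⟩
    rw [pf_step, Matrix.det_succ_row _ (Fin.last (m + 2)), Finset.mul_sum]
    refine Finset.sum_congr rfl fun j _ => ?_
    have hm : (D (m + 1) u v b).submatrix (Fin.last (m + 2)).succAbove j.succAbove =
        D m (fun i => u (j.succAbove i)) (fun i => v (j.succAbove i))
          (fun r i => b r (j.succAbove i)) := by
      ext a c
      simp [D, Fin.succAbove_last]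
    have hl : D (m + 1) u v b (Fin.last (m + 2)) j = b m j := by
      simp [D]
    rw [hm, hl, he (fun i => u (j.succAbove i)) (fun i => v (j.succAbove i))]
    have : (-1 : A) ^ (e + m + 1) * (-1) ^ ((Fin.last (m + 2)).1 + j.1) =
        (-1) ^ (j.1 + 1) * (-1) ^ e := by
      have h2 : (-1 : A) ^ (m + m + 2) = 1 := by
        rw [show m + m + 2 = 2 * (m + 1) by ring, pow_mul]; simp
      calc _ = (-1 : A) ^ (m + m + 2) * ((-1) ^ (j.1 + 1) * (-1) ^ e) := by
            simp only [Fin.val_last]; ring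
        _ = _ := by rw [h2, one_mul]
    linear_combination (- (b m j) * (D m (fun i => u (j.succAbove i))
      (fun i => v (j.succAbove i)) (fun r i => b r (j.succAbove i))).det) * this

/-- Banded Toeplitz rows. -/
def band (x0 x1 x2 : A) (r c : ℕ) : A :=
  if c = r then x0 else if c = r + 1 then x1 else if c = r + 2 then x2 else 0

/-- Tridiagonal matrix. -/
def tri (x0 x1 x2 : A) (m : ℕ) : Matrix (Fin m) (Fin m) A :=
  fun i j => band x0 x1 x2 i.1 (j.1 + 1)

lemma tri_rec (x0 x1 x2 : A) (m : ℕ) : (tri x0 x1 x2 (m + 2)).det =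
    x1 * (tri x0 x1 x2 (m + 1)).det - x0 * x2 * (tri x0 x1 x2 m).det := by
  rw [Matrix.det_succ_row_zero, Fin.sum_univ_succ, Fin.sum_univ_succ, Finset.sum_eq_zero]
  · have h1 : (tri x0 x1 x2 (m + 2)).submatrix Fin.succ (Fin.succAbove 0) =
        tri x0 x1 x2 (m + 1) := by
      ext a c; simp [tri, band]
    have h2 : ((tri x0 x1 x2 (m + 2)).submatrix Fin.succ
        (Fin.succAbove (Fin.succ 0))).det = x0 * (tri x0 x1 x2 m).det := by
      rw [Matrix.det_succ_column_zero, Fin.sum_univ_succ, Finset.sum_eq_zero]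
      · have h3 : ((tri x0 x1 x2 (m + 2)).submatrix Fin.succ
          (Fin.succAbove (Fin.succ 0))).submatrix (Fin.succAbove 0) Fin.succ =
            tri x0 x1 x2 m := by
          ext a c
          simp [tri, band, Fin.succAbove, Fin.lt_def]
        rw [h3]
        simp [tri, band, Fin.succAbove, Fin.lt_def]
      · intro i _
        simp [tri, band, Fin.succAbove, Fin.lt_def]
    rw [h1, h2]
    simp [tri, band]
    ring
  · intro i _
    simp [tri, band]

lemma det_band_x2 (x0 x1 x2 : A) (m : ℕ) (u v : Fin (m + 2) → A) :
    (D (m + 1) (Fin.snoc u 0 : Fin (m + 3) → A) (Fin.snoc v 0 : Fin (m + 3) → A)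
      (fun r c => band x0 x1 x2 r c.1)).det =
      x2 * (D m u v (fun r c => band x0 x1 x2 r c.1)).det := by
  rw [Matrix.det_succ_column _ (Fin.last (m + 2)), Finset.sum_eq_single (Fin.last (m + 2))]
  · have h1 : (D (m + 1) (Fin.snoc u 0 : Fin (m + 3) → A) (Fin.snoc v 0 : Fin (m + 3) → A)
      (fun r c => band x0 x1 x2 r c.1)).submatrix (Fin.last (m + 2)).succAbove
        (Fin.last (m + 2)).succAbove = D m u v (fun r c => band x0 x1 x2 r c.1) := by
      ext a c
      simp [D, Fin.succAbove_last, Fin.snoc_castSucc]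
    rw [h1]
    have h2 : (-1 : A) ^ (m + 2 + (m + 2)) = 1 := by
      rw [← two_mul, pow_mul]; simp
    simp [D, band, h2]
  · intro i _ hi
    have hi' : i.1 ≠ m + 2 := fun h => hi (Fin.ext h)
    have := i.2
    have h0 : (D (m + 1) (Fin.snoc u 0 : Fin (m + 3) → A) (Fin.snoc v 0 : Fin (m + 3) → A)
      (fun r c => band x0 x1 x2 r c.1)) i (Fin.last (m + 2)) = 0 := by
      simp only [D, band, Fin.snoc_last, Fin.val_last]
      split_ifs <;> first | rfl | omega
    rw [h0]; ring
  · simp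

lemma det_band_x0 (x0 x1 x2 : A) (m : ℕ) (u v : Fin (m + 2) → A) :
    (D (m + 1) (Fin.cons 0 u : Fin (m + 3) → A) (Fin.cons 0 v : Fin (m + 3) → A)
      (fun r c => band x0 x1 x2 r c.1)).det =
      x0 * (D m u v (fun r c => band x0 x1 x2 r c.1)).det := by
  have hlt : 2 < m + 3 := by omega
  rw [Matrix.det_succ_column_zero, Finset.sum_eq_single (⟨2, hlt⟩ : Fin (m + 3))]
  · have h1 : (D (m + 1) (Fin.cons 0 u : Fin (m + 3) → A) (Fin.cons 0 v : Fin (m + 3) → A)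
      (fun r c => band x0 x1 x2 r c.1)).submatrix (⟨2, hlt⟩ : Fin (m + 3)).succAbove
        Fin.succ = D m u v (fun r c => band x0 x1 x2 r c.1) := by
      ext a c
      have key : ((⟨2, hlt⟩ : Fin (m + 3)).succAbove a).1 = if a.1 < 2 then a.1 else a.1 + 1 := by
        simp only [Fin.succAbove, Fin.lt_def]
        split_ifs <;> simp_all
      by_cases ha : a.1 < 2
      · rw [if_pos ha] at key
        simp only [D, Matrix.submatrix_apply, key, Fin.cons_succ]
        split_ifs <;> first | rfl | omega
      · rw [if_neg ha] at key
        have e1 : ¬ a.1 = 0 := by omega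
        have e2 : ¬ a.1 = 1 := by omega
        have e4 : a.1 + 1 - 2 = (a.1 - 2) + 1 := by omega
        simp only [D, Matrix.submatrix_apply, key, Fin.cons_succ, e4, band, Fin.val_succ]
        simp [e1, e2]
    rw [h1]
    simp [D, band]
  · intro i _ hi
    have hi' : i.1 ≠ 2 := fun h => hi (Fin.ext (by simpa using h))
    have h0 : (D (m + 1) (Fin.cons 0 u : Fin (m + 3) → A) (Fin.cons 0 v : Fin (m + 3) → A)
      (fun r c => band x0 x1 x2 r c.1)) i 0 = 0 := by
      have hi2 : ¬ i.1 = 2 := hi'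
      by_cases h0 : i.1 = 0
      · simp [D, h0]
      by_cases h1 : i.1 = 1
      · simp [D, h1]
      have h3 : ¬ (0 = i.1 - 2) := by
        intro h
        apply hi2
        clear hi hi' hi2
        omega
      simp [D, band, h0, h1, h3]
    rw [h0]; ring
  · simp

lemma det_band_tri (x0 x1 x2 : A) (m : ℕ) : ∃ e : ℕ,
    (D m (fun i => if i.1 = 0 then 1 else 0) (fun i => if i.1 = m + 1 then 1 else 0)
      (fun r c => band x0 x1 x2 r c.1)).det = (-1) ^ e * (tri x0 x1 x2 m).det := by
  refine ⟨m, ?_⟩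
  rw [Matrix.det_succ_row_zero, Finset.sum_eq_single 0]
  · rw [Matrix.det_succ_row_zero, Finset.sum_eq_single (Fin.last m)]
    · have h1 : ((D m (fun i => if i.1 = 0 then 1 else 0)
        (fun i => if i.1 = m + 1 then 1 else 0)
        (fun r c => band x0 x1 x2 r c.1)).submatrix Fin.succ
          (Fin.succAbove 0)).submatrix Fin.succ (Fin.last m).succAbove = tri x0 x1 x2 m := by
        ext a c
        simp [D, tri, Fin.succAbove_last]
      rw [h1]
      simp [D]
    · intro i _ hi
      have hi' : i.1 ≠ m := fun h => hi (Fin.ext h)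
      simp [D, hi']
    · simp
  · intro i _ hi
    have hi' : i.1 ≠ 0 := fun h => hi (Fin.ext h)
    simp [D, hi']
  · simp

end general

section poly
variable {R : Type*} [CommRing R]

/-- The band over the polynomial ring. -/
noncomputable def bd (R : Type*) [CommRing R] (m : ℕ) :
    ℕ → Fin (m + 2) → MvPolynomial (Fin 3) R :=
  fun r c => band (X 0) (X 1) (X 2) r c.1

/-- Span of the maximal minors. -/
noncomputable def W (R : Type*) [CommRing R] (m : ℕ) : Submodule R (MvPolynomial (Fin 3) R) :=
  Submodule.span R {f | ∃ u v : Fin (m + 2) → R,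
    f = (D m (fun i => C (u i)) (fun i => C (v i)) (bd R m)).det}

lemma W_x2 (m : ℕ) {f : MvPolynomial (Fin 3) R} (hf : f ∈ W R m) : X 2 * f ∈ W R (m + 1) := by
  unfold W at hf
  induction hf using Submodule.span_induction with
  | mem f h =>
    obtain ⟨u, v, rfl⟩ := h
    unfold bd
    rw [← det_band_x2]
    refine Submodule.subset_span ⟨(Fin.snoc u 0 : Fin (m + 3) → R),
      (Fin.snoc v 0 : Fin (m + 3) → R), ?_⟩
    congr 2
    · funext i
      refine Fin.lastCases ?_ (fun i => ?_) i <;> simp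
    · funext i
      refine Fin.lastCases ?_ (fun i => ?_) i <;> simp
  | zero => simp
  | add f g _ _ hf hg => rw [mul_add]; exact add_mem hf hg
  | smul a f _ hf => rw [mul_smul_comm]; exact Submodule.smul_mem _ _ hf

lemma W_x0 (m : ℕ) {f : MvPolynomial (Fin 3) R} (hf : f ∈ W R m) : X 0 * f ∈ W R (m + 1) := by
  unfold W at hf
  induction hf using Submodule.span_induction with
  | mem f h =>
    obtain ⟨u, v, rfl⟩ := h
    unfold bd
    rw [← det_band_x0]
    refine Submodule.subset_span ⟨(Fin.cons 0 u : Fin (m + 3) → R),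
      (Fin.cons 0 v : Fin (m + 3) → R), ?_⟩
    congr 2
    · funext i
      refine Fin.cases ?_ (fun i => ?_) i <;> simp
    · funext i
      refine Fin.cases ?_ (fun i => ?_) i <;> simp
  | zero => simp
  | add f g _ _ hf hg => rw [mul_add]; exact add_mem hf hg
  | smul a f _ hf => rw [mul_smul_comm]; exact Submodule.smul_mem _ _ hf

lemma W_tri (m : ℕ) :
    (tri (X 0) (X 1) (X 2) m : Matrix _ _ (MvPolynomial (Fin 3) R)).det ∈ W R m := by
  obtain ⟨e, he⟩ := det_band_tri (X 0 : MvPolynomial (Fin 3) R) (X 1) (X 2) m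
  have h1 : ((-1 : R) ^ e) • (D m (fun i => if i.1 = 0 then 1 else 0)
      (fun i => if i.1 = m + 1 then 1 else 0)
      (fun r c => band (X 0 : MvPolynomial (Fin 3) R) (X 1) (X 2) r c.1)).det ∈ W R m := by
    refine Submodule.smul_mem _ _ (Submodule.subset_span
      ⟨fun i => if i.1 = 0 then 1 else 0, fun i => if i.1 = m + 1 then 1 else 0, ?_⟩)
    unfold bd
    congr 2
    · funext i
      by_cases h : i.1 = 0
      · simp only [h, if_true, if_false, C_1]
      · simp only [h, if_true, if_false, C_0]
    · funext i
      by_cases h : i.1 = m + 1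
      · simp only [h, if_true, if_false, C_1]
      · simp only [h, if_true, if_false, C_0]
  rw [he, MvPolynomial.smul_eq_C_mul, ← mul_assoc] at h1
  have h2 : (C ((-1 : R) ^ e) : MvPolynomial (Fin 3) R) * (-1) ^ e = 1 := by
    rw [C_pow, ← mul_pow]; simp
  rwa [h2, one_mul] at h1

lemma tri_hom (m : ℕ) :
    ((tri (X 0) (X 1) (X 2) m : Matrix _ _ (MvPolynomial (Fin 3) R)).det.IsHomogeneous m) ∧
    ((tri (X 0) (X 1) (X 2) (m + 1) :
      Matrix _ _ (MvPolynomial (Fin 3) R)).det.IsHomogeneous (m + 1)) ∧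
    ∃ q : MvPolynomial (Fin 3) R, q.IsHomogeneous m ∧
      (tri (X 0) (X 1) (X 2) (m + 1)).det = X 1 ^ (m + 1) + X 2 * q := by
  have hX : ∀ i : Fin 3, (X i : MvPolynomial (Fin 3) R).IsHomogeneous 1 :=
    fun i => isHomogeneous_X R i
  induction m with
  | zero =>
    refine ⟨?_, ?_, 0, isHomogeneous_zero _ _ _, ?_⟩
    · simpa using isHomogeneous_one _ _
    · simpa [tri, band] using hX 1
    · simp [tri, band]
  | succ m ih =>
    obtain ⟨h0, h1, q, hq, h⟩ := ih
    have h2 : (X 1 * q - X 0 * (tri (X 0) (X 1) (X 2) m).det :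
        MvPolynomial (Fin 3) R).IsHomogeneous (m + 1) := by
      rw [add_comm m 1]
      exact ((hX 1).mul hq).sub ((hX 0).mul h0)
    have h3 : (tri (X 0) (X 1) (X 2) (m + 1 + 1) : Matrix _ _ (MvPolynomial (Fin 3) R)).det =
      X 1 ^ (m + 1 + 1) + X 2 * (X 1 * q - X 0 * (tri (X 0) (X 1) (X 2) m).det) := by
      rw [tri_rec, h]; ring
    refine ⟨h1, ?_, _, h2, h3⟩
    rw [h3]
    refine (isHomogeneous_X_pow _ _).add ?_
    rw [add_comm (m + 1) 1]
    exact (hX 2).mul h2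

lemma mem_of_monomials (m : ℕ) (S : Submodule R (MvPolynomial (Fin 3) R))
    (h : ∀ i j k : ℕ, i + j + k = m → (X 0 ^ i * X 1 ^ j * X 2 ^ k : MvPolynomial (Fin 3) R) ∈ S)
    {f : MvPolynomial (Fin 3) R} (hf : f.IsHomogeneous m) : f ∈ S := by
  rw [f.as_sum]
  refine Submodule.sum_mem _ fun s hs => ?_
  have hd := hf (mem_support_iff.mp hs)
  rw [← mul_one (coeff s f), ← smul_eq_mul, ← smul_monomial]
  refine Submodule.smul_mem _ _ ?_
  rw [monomial_eq, Finsupp.prod_fintype _ _ (by simp), Fin.prod_univ_three, C_1, one_mul]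
  apply h
  rw [← hd, Finsupp.weight_apply, Finsupp.sum_fintype _ _ (by simp), Fin.sum_univ_three]
  simp

lemma hom_mem_W (m : ℕ) : ∀ f : MvPolynomial (Fin 3) R, f.IsHomogeneous m → f ∈ W R m := by
  induction m with
  | zero =>
    intro f hf
    refine mem_of_monomials 0 _ ?_ hf
    intro i j k hijk
    obtain ⟨rfl, rfl, rfl⟩ : i = 0 ∧ j = 0 ∧ k = 0 := by omega
    simpa using W_tri (R := R) 0
  | succ m ih =>
    intro f hf
    have hmon : ∀ i j k : ℕ, i + j + k = m →
        (X 0 ^ i * X 1 ^ j * X 2 ^ k : MvPolynomial (Fin 3) R).IsHomogeneous m := by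
      intro i j k h
      rw [← h]
      exact ((isHomogeneous_X_pow _ _).mul (isHomogeneous_X_pow _ _)).mul
        (isHomogeneous_X_pow _ _)
    refine mem_of_monomials (m + 1) _ ?_ hf
    intro i j k hijk
    rcases Nat.eq_zero_or_pos k with hk | hk
    · rcases Nat.eq_zero_or_pos i with hi | hi
      · subst hk hi
        obtain rfl : j = m + 1 := by omega
        obtain ⟨-, -, q, hq, h⟩ := tri_hom (R := R) m
        have := sub_mem (W_tri (R := R) (m + 1)) (W_x2 m (ih q hq))
        rw [h, add_sub_cancel_right] at this
        simpa using this
      · obtain ⟨i, rfl⟩ := Nat.exists_eq_succ_of_ne_zero hi.ne'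
        have := W_x0 m (ih _ (hmon i j k (by omega)))
        convert this using 1
        rw [Nat.succ_eq_add_one, pow_succ]; ring
    · obtain ⟨k, rfl⟩ := Nat.exists_eq_succ_of_ne_zero hk.ne'
      have := W_x2 m (ih _ (hmon i j k (by omega)))
      convert this using 1
      rw [Nat.succ_eq_add_one, pow_succ]; ring

lemma W_rep (m : ℕ) {f : MvPolynomial (Fin 3) R} (hf : f ∈ W R m) :
    ∃ N : Fin (m + 2) → Fin (m + 2) → R, (∀ i j, N j i = - N i j) ∧
      matrixPfaffian (m + 1) (G m (fun i j => C (N i j)) (bd R m)) = f := by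
  unfold W at hf
  have hs : ∀ (a : R) (f : MvPolynomial (Fin 3) R),
      (∃ N : Fin (m + 2) → Fin (m + 2) → R, (∀ i j, N j i = - N i j) ∧
      matrixPfaffian (m + 1) (G m (fun i j => C (N i j)) (bd R m)) = f) →
      (∃ N : Fin (m + 2) → Fin (m + 2) → R, (∀ i j, N j i = - N i j) ∧
      matrixPfaffian (m + 1) (G m (fun i j => C (N i j)) (bd R m)) = C a * f) := by
    rintro a f ⟨N, hN, rfl⟩
    refine ⟨fun i j => a * N i j, fun i j => by simp only [hN i j]; ring, ?_⟩
    rw [← pf_smul]; simp only [C_mul]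
  induction hf using Submodule.span_induction with
  | mem f h =>
    obtain ⟨u, v, rfl⟩ := h
    obtain ⟨e, he⟩ := pf_wedge (A := MvPolynomial (Fin 3) R) m
    obtain ⟨N, hN, h⟩ := hs ((-1) ^ e) _ ⟨fun i j => u i * v j - u j * v i,
      fun i j => by ring, rfl⟩
    refine ⟨N, hN, h.trans ?_⟩
    simp only [C_sub, C_mul]
    rw [he (fun i => C (u i)) (fun i => C (v i)), ← mul_assoc, C_pow, ← mul_pow]
    simp
  | zero =>
    refine ⟨fun _ _ => 0, by simp, ?_⟩
    have := pf_smul m (0 : MvPolynomial (Fin 3) R) (fun _ _ => 0) (bd R m)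
    simpa using this
  | add f g _ _ hf hg =>
    obtain ⟨N, hN, rfl⟩ := hf
    obtain ⟨N', hN', rfl⟩ := hg
    refine ⟨fun i j => N i j + N' i j, fun i j => by simp only [hN i j, hN' i j]; ring, ?_⟩
    rw [← pf_add]; simp only [C_add]
  | smul a f _ hf => rw [MvPolynomial.smul_eq_C_mul]; exact hs a f hf

/-- Linear representability by skew matrices. -/
def Rep (m : ℕ) (f : MvPolynomial (Fin 3) R) : Prop :=
  ∃ N : Fin 3 → Fin (m + 2) → Fin (m + 2) → R, (∀ l i j, N l j i = - N l i j) ∧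
    matrixPfaffian (m + 1) (G m (fun i j => X 0 * C (N 0 i j) + X 1 * C (N 1 i j) +
      X 2 * C (N 2 i j)) (bd R m)) = f

lemma rep_of (m : ℕ) (f g h : MvPolynomial (Fin 3) R) (hf : f.IsHomogeneous m)
    (hg : g.IsHomogeneous m) (hh : h.IsHomogeneous m) :
    Rep m (X 0 * f + X 1 * g + X 2 * h) := by
  obtain ⟨N0, h0, rfl⟩ := W_rep m (hom_mem_W m f hf)
  obtain ⟨N1, h1, rfl⟩ := W_rep m (hom_mem_W m g hg)
  obtain ⟨N2, h2, rfl⟩ := W_rep m (hom_mem_W m h hh)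
  refine ⟨![N0, N1, N2], ?_, ?_⟩
  · intro l i j
    fin_cases l
    · exact h0 i j
    · exact h1 i j
    · exact h2 i j
  · rw [← pf_smul, ← pf_smul, ← pf_smul, ← pf_add, ← pf_add]
    rfl

lemma rep_add (m : ℕ) (f g : MvPolynomial (Fin 3) R) (hf : Rep m f) (hg : Rep m g) :
    Rep m (f + g) := by
  obtain ⟨N, hN, rfl⟩ := hf
  obtain ⟨N', hN', rfl⟩ := hg
  refine ⟨fun l i j => N l i j + N' l i j, fun l i j => by simp only [hN l i j, hN' l i j]; ring, ?_⟩
  rw [← pf_add]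
  congr 2
  funext i j
  simp only [C_add]; ring

lemma rep_monomial (m : ℕ) (a : R) (i j k : ℕ) (h : i + j + k = m + 1) :
    Rep m (C a * X 0 ^ i * X 1 ^ j * X 2 ^ k : MvPolynomial (Fin 3) R) := by
  have hmon : ∀ i j k : ℕ, i + j + k = m →
      (C a * X 0 ^ i * X 1 ^ j * X 2 ^ k : MvPolynomial (Fin 3) R).IsHomogeneous m := by
    intro i j k h
    have := (((isHomogeneous_C (Fin 3) a).mul (isHomogeneous_X_pow 0 i)).mul
      (isHomogeneous_X_pow 1 j)).mul (isHomogeneous_X_pow (R := R) (2 : Fin 3) k)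
    rwa [zero_add, h] at this
  have hz := isHomogeneous_zero (Fin 3) R m
  rcases Nat.eq_zero_or_pos i with hi | hi
  · rcases Nat.eq_zero_or_pos j with hj | hj
    · obtain ⟨k, rfl⟩ := Nat.exists_eq_succ_of_ne_zero (show k ≠ 0 by omega)
      have := rep_of m 0 0 _ hz hz (hmon i j k (by omega))
      convert this using 1
      rw [Nat.succ_eq_add_one, pow_succ]; ring
    · obtain ⟨j, rfl⟩ := Nat.exists_eq_succ_of_ne_zero hj.ne'
      have := rep_of m 0 _ 0 hz (hmon i j k (by omega)) hz
      convert this using 1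
      rw [Nat.succ_eq_add_one, pow_succ]; ring
  · obtain ⟨i, rfl⟩ := Nat.exists_eq_succ_of_ne_zero hi.ne'
    have := rep_of m _ 0 0 (hmon i j k (by omega)) hz hz
    convert this using 1
    rw [Nat.succ_eq_add_one, pow_succ]; ring

lemma G_skew (m : ℕ) (N : Fin (m + 2) → Fin (m + 2) → R) (b : ℕ → Fin (m + 2) → R)
    (hN : ∀ i j, N j i = - N i j) : (G m N b)ᵀ = - G m N b := by
  ext p q
  simp only [Matrix.transpose_apply, Matrix.neg_apply, G]
  split_ifs
  · exact hN _ _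
  · rfl
  · rw [neg_neg]
  · rw [neg_zero]

lemma rep_final (m : ℕ) (f : MvPolynomial (Fin 3) R) (hf : Rep m f) :
    ∃ A₀ A₁ A₂ : Matrix (Fin (2 * (m + 1))) (Fin (2 * (m + 1))) R,
      A₀ᵀ = -A₀ ∧ A₁ᵀ = -A₁ ∧ A₂ᵀ = -A₂ ∧
      matrixPfaffian (m + 1)
        ((X 0 : MvPolynomial (Fin 3) R) • A₀.map C + (X 1 : MvPolynomial (Fin 3) R) • A₁.map C +
          (X 2 : MvPolynomial (Fin 3) R) • A₂.map C) = f := by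
  obtain ⟨N, hN, rfl⟩ := hf
  refine ⟨G m (N 0) (fun r c => band 1 0 0 r c.1), G m (N 1) (fun r c => band 0 1 0 r c.1),
    G m (N 2) (fun r c => band 0 0 1 r c.1), G_skew _ _ _ (hN 0), G_skew _ _ _ (hN 1),
    G_skew _ _ _ (hN 2), ?_⟩
  congr 1
  have hb : ∀ r c : ℕ, (X 0 * C (band 1 0 0 r c) + X 1 * C (band 0 1 0 r c) +
      X 2 * C (band 0 0 1 r c) : MvPolynomial (Fin 3) R) = band (X 0) (X 1) (X 2) r c := by
    intro r c
    unfold band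
    split_ifs <;> simp
  ext1 p q
  simp only [Matrix.add_apply, Matrix.smul_apply, Matrix.map_apply, smul_eq_mul, G, bd]
  split_ifs
  · rfl
  · rw [← hb]; simp only [C_neg]; ring
  · rw [← hb]
  · simp

end poly

end PfRep

/-- Over `Z = ℤ[Θ_{ijk} : i+j+k = d]`, the generic ternary form
`∑_{i+j+k=d} Θ_{ijk} X₀^i X₁^j X₂^k` of degree `d`, `2 ≤ d ≤ 25`, admits a linear
Pfaffian representation. -/
theorem generic_ternary_form_of_degree_le_25_admits_linear_pfaffian_representation
    (d : ℕ) (hd2 : 2 ≤ d) (hd25 : d ≤ 25) :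
    ∃ A₀ A₁ A₂ : Matrix (Fin (2 * d)) (Fin (2 * d)) (GenericCoeffRing d),
      A₀ᵀ = -A₀ ∧ A₁ᵀ = -A₁ ∧ A₂ᵀ = -A₂ ∧
      matrixPfaffian d
        ((X 0 : MvPolynomial (Fin 3) (GenericCoeffRing d)) • A₀.map C +
          (X 1 : MvPolynomial (Fin 3) (GenericCoeffRing d)) • A₁.map C +
          (X 2 : MvPolynomial (Fin 3) (GenericCoeffRing d)) • A₂.map C) =
        (∑ᶠ p : {p : ℕ × ℕ × ℕ // p.1 + p.2.1 + p.2.2 = d},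
          C (X p) * X 0 ^ p.1.1 * X 1 ^ p.1.2.1 * X 2 ^ p.1.2.2 :
            MvPolynomial (Fin 3) (GenericCoeffRing d)) := by
  obtain ⟨m, rfl⟩ : ∃ m, d = m + 1 := ⟨d - 1, by omega⟩
  apply PfRep.rep_final
  refine finsum_induction (PfRep.Rep m) ?_ (fun f g hf hg => PfRep.rep_add m f g hf hg) ?_
  · have hz := isHomogeneous_zero (Fin 3) (GenericCoeffRing (m + 1)) m
    simpa using PfRep.rep_of m 0 0 0 hz hz hz
  · intro p
    exact PfRep.rep_monomial m _ _ _ _ p.2
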